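/- Let S be a Cu-semigroup. Then ⟦S,S⟧, equipped with the composition product as multiplication and with the class ⟨id_S⟩ of the constant path at the identity map as unit, is a Cu-semiring (not necessarily commutative); moreover its unit ⟨id_S⟩ is a compact element of ⟦S,S⟧. -/

import Mathlib

/-! ### Abstract Cuntz semigroups: basic framework -/

/-- The way-below (compact containment) relation. -/
def WayBelow {S : Type*} [Preorder S] (a b : S) : Prop :=
  ∀ c : ℕ → S, Monotone c → ∀ s : S, IsLUB (Set.range c) s → b ≤ s → ∃ n, a ≤ c n

/-- A `Cu`-semigroup (abstract Cuntz semigroup): a positively ordered monoid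
satisfying the axioms (O1)-(O4). -/
class CuSemigroup (S : Type*) [AddCommMonoid S] [PartialOrder S] : Prop where
  add_le_add' : ∀ a b c d : S, a ≤ b → c ≤ d → a + c ≤ b + d
  zero_le' : ∀ a : S, (0 : S) ≤ a
  O1 : ∀ c : ℕ → S, Monotone c → ∃ s : S, IsLUB (Set.range c) s
  O2 : ∀ a : S, ∃ c : ℕ → S, (∀ n, WayBelow (c n) (c (n + 1))) ∧ IsLUB (Set.range c) a
  O3 : ∀ a' a b' b : S, WayBelow a' a → WayBelow b' b → WayBelow (a' + b') (a + b)
  O4 : ∀ (c d : ℕ → S) (s t : S), Monotone c → Monotone d →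
      IsLUB (Set.range c) s → IsLUB (Set.range d) t →
      IsLUB (Set.range (fun n => c n + d n)) (s + t)

section WayBelowBasic

variable {S : Type*} [Preorder S]

theorem WayBelow.le {a b : S} (h : WayBelow a b) : a ≤ b := by
  obtain ⟨n, hn⟩ := h (fun _ => b) monotone_const b
    (by rw [Set.range_const]; exact isLUB_singleton) le_rfl
  exact hn

theorem WayBelow.of_le_left {x a b : S} (hx : x ≤ a) (h : WayBelow a b) : WayBelow x b :=
  fun c hc s hs hbs => (h c hc s hs hbs).imp fun _ hn => hx.trans hn

theorem WayBelow.of_le_right {a b y : S} (h : WayBelow a b) (hy : b ≤ y) : WayBelow a y :=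
  fun c hc s hs hys => h c hc s hs (hy.trans hys)

end WayBelowBasic

theorem wayBelow_zero {S : Type*} [AddCommMonoid S] [PartialOrder S] [CuSemigroup S] {a : S} :
    WayBelow (0 : S) a :=
  fun _ _ _ _ _ => ⟨0, CuSemigroup.zero_le' _⟩

/-- Interpolation: if `a' ≪ a` then there is `x` with `a' ≪ x ≪ a`. -/
theorem exists_interpolate {S : Type*} [AddCommMonoid S] [PartialOrder S] [CuSemigroup S]
    {a' a : S} (h : WayBelow a' a) : ∃ x : S, WayBelow a' x ∧ WayBelow x a := by
  obtain ⟨c, hc, hlub⟩ := CuSemigroup.O2 a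
  have hmono : Monotone c := monotone_nat_of_le_succ fun n => (hc n).le
  obtain ⟨n, hn⟩ := h c hmono a hlub le_rfl
  exact ⟨c (n + 1), WayBelow.of_le_left hn (hc n),
    WayBelow.of_le_right (hc (n + 1)) (hlub.1 (Set.mem_range_self (n + 2)))⟩

/-! ### Generalized Cu-morphisms -/

/-- A generalized `Cu`-morphism: additive, monotone, zero preserving map which preserves
suprema of increasing sequences. -/
structure GenCuMor (S : Type*) (T : Type*) [AddCommMonoid S] [PartialOrder S]
    [AddCommMonoid T] [PartialOrder T] where
  toFun : S → T
  map_zero' : toFun 0 = 0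
  map_add' : ∀ a b : S, toFun (a + b) = toFun a + toFun b
  mono' : Monotone toFun
  map_sup' : ∀ (c : ℕ → S) (s : S), Monotone c → IsLUB (Set.range c) s →
    IsLUB (Set.range (fun n => toFun (c n))) (toFun s)

namespace GenCuMor

variable {S T P : Type*} [AddCommMonoid S] [PartialOrder S] [AddCommMonoid T] [PartialOrder T]
  [AddCommMonoid P] [PartialOrder P]

theorem ext' {f g : GenCuMor S T} (h : f.toFun = g.toFun) : f = g := by
  cases f; cases g; cases h; rfl

instance : PartialOrder (GenCuMor S T) where
  le f g := ∀ a : S, f.toFun a ≤ g.toFun a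
  le_refl f a := le_rfl
  le_trans f g h h1 h2 a := (h1 a).trans (h2 a)
  le_antisymm f g h1 h2 := ext' (funext fun a => le_antisymm (h1 a) (h2 a))

theorem le_def {f g : GenCuMor S T} : f ≤ g ↔ ∀ a : S, f.toFun a ≤ g.toFun a := Iff.rfl

instance : Zero (GenCuMor S T) where
  zero :=
    { toFun := fun _ => 0
      map_zero' := rfl
      map_add' := fun _ _ => (add_zero 0).symm
      mono' := monotone_const
      map_sup' := fun _ _ _ _ => by
        rw [Set.range_const]; exact isLUB_singleton }

@[simp] theorem zero_toFun (a : S) : (0 : GenCuMor S T).toFun a = 0 := rfl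

instance [CuSemigroup T] : Add (GenCuMor S T) where
  add f g :=
    { toFun := fun a => f.toFun a + g.toFun a
      map_zero' := by show f.toFun 0 + g.toFun 0 = 0; rw [f.map_zero', g.map_zero', add_zero]
      map_add' := by
        intro a b
        show f.toFun (a + b) + g.toFun (a + b) = _
        rw [f.map_add', g.map_add', add_add_add_comm]
      mono' := fun a b h => CuSemigroup.add_le_add' _ _ _ _ (f.mono' h) (g.mono' h)
      map_sup' := fun c s hc hs =>
        CuSemigroup.O4 (fun n => f.toFun (c n)) (fun n => g.toFun (c n)) _ _
          (fun _ _ h => f.mono' (hc h)) (fun _ _ h => g.mono' (hc h))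
          (f.map_sup' c s hc hs) (g.map_sup' c s hc hs) }

@[simp] theorem add_toFun [CuSemigroup T] (f g : GenCuMor S T) (a : S) :
    (f + g).toFun a = f.toFun a + g.toFun a := rfl

instance [CuSemigroup T] : AddCommMonoid (GenCuMor S T) where
  add := (· + ·)
  zero := 0
  add_assoc f g h := ext' (funext fun a => add_assoc (f.toFun a) (g.toFun a) (h.toFun a))
  zero_add f := ext' (funext fun a => zero_add (f.toFun a))
  add_zero f := ext' (funext fun a => add_zero (f.toFun a))
  add_comm f g := ext' (funext fun a => add_comm (f.toFun a) (g.toFun a))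
  nsmul := nsmulRec
  nsmul_zero := fun _ => rfl
  nsmul_succ := fun _ _ => rfl

/-- Composition of generalized Cu-morphisms. -/
def comp (g : GenCuMor T P) (f : GenCuMor S T) : GenCuMor S P where
  toFun := fun a => g.toFun (f.toFun a)
  map_zero' := by show g.toFun (f.toFun 0) = 0; rw [f.map_zero', g.map_zero']
  map_add' := fun a b => by
    show g.toFun (f.toFun (a + b)) = g.toFun (f.toFun a) + g.toFun (f.toFun b)
    rw [f.map_add', g.map_add']
  mono' := fun a b h => g.mono' (f.mono' h)
  map_sup' := fun c s hc hs =>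
    g.map_sup' (fun n => f.toFun (c n)) (f.toFun s) (fun _ _ h => f.mono' (hc h))
      (f.map_sup' c s hc hs)

@[simp] theorem comp_toFun (g : GenCuMor T P) (f : GenCuMor S T) (a : S) :
    (g.comp f).toFun a = g.toFun (f.toFun a) := rfl

/-- The identity generalized Cu-morphism. -/
def id (S : Type*) [AddCommMonoid S] [PartialOrder S] : GenCuMor S S where
  toFun := fun a => a
  map_zero' := rfl
  map_add' := fun _ _ => rfl
  mono' := monotone_id
  map_sup' := fun _ _ _ hs => hs

end GenCuMor

/-- The auxiliary relation `f ≺ g` on generalized Cu-morphisms. -/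
def Prec {S T : Type*} [AddCommMonoid S] [PartialOrder S] [AddCommMonoid T] [PartialOrder T]
    (f g : GenCuMor S T) : Prop :=
  ∀ a' a : S, WayBelow a' a → WayBelow (f.toFun a') (g.toFun a)

namespace Prec

variable {S T P : Type*} [AddCommMonoid S] [PartialOrder S] [AddCommMonoid T] [PartialOrder T]
  [AddCommMonoid P] [PartialOrder P]

theorem trans [CuSemigroup S] {f g h : GenCuMor S T} (h1 : Prec f g) (h2 : Prec g h) :
    Prec f h := by
  intro a' a ha
  obtain ⟨x, hx1, hx2⟩ := exists_interpolate ha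
  exact WayBelow.of_le_left (h1 a' x hx1).le (h2 x a hx2)

theorem add [CuSemigroup T] {f g f' g' : GenCuMor S T} (h : Prec f g) (h' : Prec f' g') :
    Prec (f + f') (g + g') :=
  fun a' a ha => CuSemigroup.O3 _ _ _ _ (h a' a ha) (h' a' a ha)

theorem comp {f f' : GenCuMor S T} {g g' : GenCuMor T P} (hf : Prec f f') (hg : Prec g g') :
    Prec (g.comp f) (g'.comp f') :=
  fun a' a ha => hg _ _ (hf a' a ha)

end Prec

/-! ### Paths and the bivariant Cu-semigroup -/

/-- The index set `ℚ ∩ (0,1)` for paths. -/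
abbrev IQ : Type := {q : ℚ // 0 < q ∧ q < 1}

theorem IQ.exists_gt (l : IQ) : ∃ m : IQ, l.1 < m.1 := by
  refine ⟨⟨(l.1 + 1) / 2, ⟨by linarith [l.2.1, l.2.2], by linarith [l.2.2]⟩⟩, ?_⟩
  simp only
  linarith [l.2.2]

theorem IQ.exists_gt₂ (l m : IQ) : ∃ r : IQ, l.1 < r.1 ∧ m.1 < r.1 := by
  have h1 : l.1 ≤ max l.1 m.1 := le_max_left _ _
  have h2 : m.1 ≤ max l.1 m.1 := le_max_right _ _
  have ht : max l.1 m.1 < 1 := max_lt l.2.2 m.2.2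
  have ht0 : 0 < max l.1 m.1 := lt_of_lt_of_le l.2.1 h1
  refine ⟨⟨(max l.1 m.1 + 1) / 2, ⟨by linarith, by linarith⟩⟩, ?_, ?_⟩ <;>
    simp only <;> linarith

/-- A path of generalized Cu-morphisms: a `ℚ ∩ (0,1)`-indexed family which is increasing
with respect to the auxiliary relation `≺`. -/
structure CuPath (S T : Type*) [AddCommMonoid S] [PartialOrder S]
    [AddCommMonoid T] [PartialOrder T] where
  f : IQ → GenCuMor S T
  prec : ∀ l m : IQ, l.1 < m.1 → Prec (f l) (f m)

namespace CuPath

variable {S T P : Type*} [AddCommMonoid S] [PartialOrder S] [AddCommMonoid T] [PartialOrder T]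
  [AddCommMonoid P] [PartialOrder P]

theorem ext' {p q : CuPath S T} (h : p.f = q.f) : p = q := by
  cases p; cases q; cases h; rfl

end CuPath

/-- The preorder `f ≾ g` on paths. -/
def PathLE {S T : Type*} [AddCommMonoid S] [PartialOrder S] [AddCommMonoid T] [PartialOrder T]
    (p q : CuPath S T) : Prop :=
  ∀ l : IQ, ∃ m : IQ, Prec (p.f l) (q.f m)

/-- The equivalence relation on paths: `p ∼ q` iff `p ≾ q` and `q ≾ p`. -/
def PathEquiv {S T : Type*} [AddCommMonoid S] [PartialOrder S] [AddCommMonoid T] [PartialOrder T]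
    (p q : CuPath S T) : Prop :=
  PathLE p q ∧ PathLE q p

namespace PathLE

variable {S T : Type*} [AddCommMonoid S] [PartialOrder S] [AddCommMonoid T] [PartialOrder T]

theorem refl (p : CuPath S T) : PathLE p p := fun l =>
  let ⟨m, hm⟩ := IQ.exists_gt l
  ⟨m, p.prec l m hm⟩

theorem trans [CuSemigroup S] {p q r : CuPath S T} (h1 : PathLE p q) (h2 : PathLE q r) :
    PathLE p r := fun l =>
  let ⟨m, hm⟩ := h1 l
  let ⟨n, hn⟩ := h2 m
  ⟨n, hm.trans hn⟩

end PathLE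

instance CuPath.setoid (S T : Type*) [AddCommMonoid S] [PartialOrder S] [AddCommMonoid T]
    [PartialOrder T] [CuSemigroup S] : Setoid (CuPath S T) where
  r := PathEquiv
  iseqv :=
    { refl := fun p => ⟨PathLE.refl p, PathLE.refl p⟩
      symm := fun h => ⟨h.2, h.1⟩
      trans := fun h1 h2 => ⟨h1.1.trans h2.1, h2.2.trans h1.2⟩ }

/-- The bivariant Cu-semigroup `⟦S,T⟧`: equivalence classes of paths. -/
def BivCu (S T : Type*) [AddCommMonoid S] [PartialOrder S] [AddCommMonoid T] [PartialOrder T]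
    [CuSemigroup S] : Type _ :=
  Quotient (CuPath.setoid S T)

namespace BivCu

variable {S T P Q : Type*} [AddCommMonoid S] [PartialOrder S] [AddCommMonoid T] [PartialOrder T]
  [AddCommMonoid P] [PartialOrder P] [AddCommMonoid Q] [PartialOrder Q]

/-- Class of a path in the bivariant Cu-semigroup. -/
def mk [CuSemigroup S] (p : CuPath S T) : BivCu S T := Quotient.mk (CuPath.setoid S T) p

instance [CuSemigroup S] : PartialOrder (BivCu S T) where
  le := Quotient.lift₂ PathLE (by
    intro p q p' q' hp hq
    exact propext ⟨fun h => (hp.2.trans h).trans hq.1, fun h => (hp.1.trans h).trans hq.2⟩)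
  le_refl := by
    rintro ⟨p⟩
    exact PathLE.refl p
  le_trans := by
    rintro ⟨p⟩ ⟨q⟩ ⟨r⟩ h1 h2
    exact PathLE.trans h1 h2
  le_antisymm := by
    rintro ⟨p⟩ ⟨q⟩ h1 h2
    exact Quotient.sound ⟨h1, h2⟩

theorem mk_le_mk [CuSemigroup S] {p q : CuPath S T} : mk p ≤ mk q ↔ PathLE p q := Iff.rfl

end BivCu

/-- Pointwise addition of paths. -/
def CuPath.add {S T : Type*} [AddCommMonoid S] [PartialOrder S] [AddCommMonoid T]
    [PartialOrder T] [CuSemigroup T] (p q : CuPath S T) : CuPath S T where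
  f l := p.f l + q.f l
  prec l m h := (p.prec l m h).add (q.prec l m h)

/-- The zero path. -/
def CuPath.zero (S T : Type*) [AddCommMonoid S] [PartialOrder S] [AddCommMonoid T]
    [PartialOrder T] [CuSemigroup T] : CuPath S T where
  f _ := 0
  prec _ _ _ := fun _ _ _ => wayBelow_zero

theorem PathLE.add {S T : Type*} [AddCommMonoid S] [PartialOrder S] [AddCommMonoid T]
    [PartialOrder T] [CuSemigroup S] [CuSemigroup T] {p p' q q' : CuPath S T}
    (hp : PathLE p p') (hq : PathLE q q') : PathLE (p.add q) (p'.add q') := by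
  intro l
  obtain ⟨m1, h1⟩ := hp l
  obtain ⟨m2, h2⟩ := hq l
  obtain ⟨r, hr1, hr2⟩ := IQ.exists_gt₂ m1 m2
  exact ⟨r, (h1.trans (p'.prec m1 r hr1)).add (h2.trans (q'.prec m2 r hr2))⟩

theorem PathEquiv.add {S T : Type*} [AddCommMonoid S] [PartialOrder S] [AddCommMonoid T]
    [PartialOrder T] [CuSemigroup S] [CuSemigroup T] {p p' q q' : CuPath S T}
    (hp : PathEquiv p p') (hq : PathEquiv q q') : PathEquiv (p.add q) (p'.add q') :=
  ⟨PathLE.add hp.1 hq.1, PathLE.add hp.2 hq.2⟩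

namespace BivCu

variable {S T P : Type*} [AddCommMonoid S] [PartialOrder S] [AddCommMonoid T] [PartialOrder T]
  [AddCommMonoid P] [PartialOrder P]

instance [CuSemigroup S] [CuSemigroup T] : Add (BivCu S T) where
  add := Quotient.map₂ CuPath.add (fun _ _ hp _ _ hq => PathEquiv.add hp hq)

instance [CuSemigroup S] [CuSemigroup T] : Zero (BivCu S T) where
  zero := mk (CuPath.zero S T)

instance [CuSemigroup S] [CuSemigroup T] : AddCommMonoid (BivCu S T) where
  add := (· + ·)
  zero := 0
  add_assoc := by
    rintro ⟨p⟩ ⟨q⟩ ⟨r⟩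
    exact congrArg (Quotient.mk _) (CuPath.ext' (funext fun l => add_assoc _ _ _))
  zero_add := by
    rintro ⟨p⟩
    exact congrArg (Quotient.mk _) (CuPath.ext' (funext fun l => zero_add _))
  add_zero := by
    rintro ⟨p⟩
    exact congrArg (Quotient.mk _) (CuPath.ext' (funext fun l => add_zero _))
  add_comm := by
    rintro ⟨p⟩ ⟨q⟩
    exact congrArg (Quotient.mk _) (CuPath.ext' (funext fun l => add_comm _ _))
  nsmul := nsmulRec
  nsmul_zero := fun _ => rfl
  nsmul_succ := fun _ _ => rfl

theorem mk_add_mk [CuSemigroup S] [CuSemigroup T] (p q : CuPath S T) :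
    mk p + mk q = mk (p.add q) := rfl

end BivCu

/-- Composition of paths. -/
def CuPath.comp {S T P : Type*} [AddCommMonoid S] [PartialOrder S] [AddCommMonoid T]
    [PartialOrder T] [AddCommMonoid P] [PartialOrder P]
    (q : CuPath T P) (p : CuPath S T) : CuPath S P where
  f l := (q.f l).comp (p.f l)
  prec l m h := Prec.comp (p.prec l m h) (q.prec l m h)

theorem PathLE.comp {S T P : Type*} [AddCommMonoid S] [PartialOrder S] [AddCommMonoid T]
    [PartialOrder T] [AddCommMonoid P] [PartialOrder P] [CuSemigroup S] [CuSemigroup T]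
    {q q' : CuPath T P} {p p' : CuPath S T} (hq : PathLE q q') (hp : PathLE p p') :
    PathLE (q.comp p) (q'.comp p') := by
  intro l
  obtain ⟨m1, h1⟩ := hp l
  obtain ⟨m2, h2⟩ := hq l
  obtain ⟨r, hr1, hr2⟩ := IQ.exists_gt₂ m1 m2
  exact ⟨r, Prec.comp (h1.trans (p'.prec m1 r hr1)) (h2.trans (q'.prec m2 r hr2))⟩

theorem PathEquiv.comp {S T P : Type*} [AddCommMonoid S] [PartialOrder S] [AddCommMonoid T]
    [PartialOrder T] [AddCommMonoid P] [PartialOrder P] [CuSemigroup S] [CuSemigroup T]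
    {q q' : CuPath T P} {p p' : CuPath S T} (hq : PathEquiv q q') (hp : PathEquiv p p') :
    PathEquiv (q.comp p) (q'.comp p') :=
  ⟨PathLE.comp hq.1 hp.1, PathLE.comp hq.2 hp.2⟩

/-- The composition product on bivariant Cu-semigroups. -/
def BivCu.comp {S T P : Type*} [AddCommMonoid S] [PartialOrder S] [AddCommMonoid T]
    [PartialOrder T] [AddCommMonoid P] [PartialOrder P] [CuSemigroup S] [CuSemigroup T]
    (y : BivCu T P) (x : BivCu S T) : BivCu S P :=
  Quotient.map₂ CuPath.comp (fun _ _ hq _ _ hp => PathEquiv.comp hq hp) y x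

theorem BivCu.comp_mk_mk {S T P : Type*} [AddCommMonoid S] [PartialOrder S] [AddCommMonoid T]
    [PartialOrder T] [AddCommMonoid P] [PartialOrder P] [CuSemigroup S] [CuSemigroup T]
    (q : CuPath T P) (p : CuPath S T) :
    BivCu.comp (BivCu.mk q) (BivCu.mk p) = BivCu.mk (q.comp p) := rfl

/-- The constant path at the identity morphism. -/
def CuPath.id (S : Type*) [AddCommMonoid S] [PartialOrder S] : CuPath S S where
  f _ := GenCuMor.id S
  prec _ _ _ := fun _ _ ha => ha

/-- The class of the constant path at the identity: the unit of `⟦S,S⟧`. -/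
def BivCu.id (S : Type*) [AddCommMonoid S] [PartialOrder S] [CuSemigroup S] : BivCu S S :=
  BivCu.mk (CuPath.id S)

/-! ### Ideals, morphism predicates, bimorphisms, softness, elementary paths -/

/-- An ideal of a Cu-semigroup: a downward hereditary submonoid closed under
suprema of increasing sequences. -/
def IsCuIdeal {S : Type*} [AddCommMonoid S] [PartialOrder S] (J : Set S) : Prop :=
  (0 : S) ∈ J ∧ (∀ a b : S, a ∈ J → b ∈ J → a + b ∈ J) ∧
  (∀ a b : S, b ≤ a → a ∈ J → b ∈ J) ∧
  (∀ c : ℕ → S, Monotone c → (∀ n, c n ∈ J) → ∀ s : S, IsLUB (Set.range c) s → s ∈ J)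

/-- Predicate: `f` is (the function of) a generalized Cu-morphism. -/
def IsGenCuMorFun {S T : Type*} [AddCommMonoid S] [PartialOrder S] [AddCommMonoid T]
    [PartialOrder T] (f : S → T) : Prop :=
  f 0 = 0 ∧ (∀ a b : S, f (a + b) = f a + f b) ∧ Monotone f ∧
  ∀ (c : ℕ → S) (s : S), Monotone c → IsLUB (Set.range c) s →
    IsLUB (Set.range (fun n => f (c n))) (f s)

/-- Predicate: `f` is a Cu-morphism (generalized Cu-morphism preserving way-below). -/
def IsCuMorFun {S T : Type*} [AddCommMonoid S] [PartialOrder S] [AddCommMonoid T]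
    [PartialOrder T] (f : S → T) : Prop :=
  IsGenCuMorFun f ∧ ∀ a b : S, WayBelow a b → WayBelow (f a) (f b)

/-- Predicate: `φ` is a Cu-bimorphism. -/
def IsCuBimor {A B C : Type*} [AddCommMonoid A] [PartialOrder A] [AddCommMonoid B]
    [PartialOrder B] [AddCommMonoid C] [PartialOrder C] (φ : A → B → C) : Prop :=
  (∀ b : B, φ 0 b = 0) ∧ (∀ a : A, φ a 0 = 0) ∧
  (∀ (a a' : A) (b : B), φ (a + a') b = φ a b + φ a' b) ∧
  (∀ (a : A) (b b' : B), φ a (b + b') = φ a b + φ a b') ∧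
  (∀ (a a' : A) (b : B), a ≤ a' → φ a b ≤ φ a' b) ∧
  (∀ (a : A) (b b' : B), b ≤ b' → φ a b ≤ φ a b') ∧
  (∀ (c : ℕ → A) (d : ℕ → B) (s : A) (t : B), Monotone c → Monotone d →
    IsLUB (Set.range c) s → IsLUB (Set.range d) t →
    IsLUB (Set.range (fun n => φ (c n) (d n))) (φ s t)) ∧
  (∀ (a' a : A) (b' b : B), WayBelow a' a → WayBelow b' b → WayBelow (φ a' b') (φ a b))

/-- A path in `(R, ≪)`: a `ℚ ∩ (0,1)`-indexed family, increasing with respect to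
the way-below relation. -/
structure ElemPath (R : Type*) [Preorder R] where
  f : IQ → R
  prec : ∀ l m : IQ, l.1 < m.1 → WayBelow (f l) (f m)

/-- A soft element of a Cu-semigroup. -/
def IsSoft {S : Type*} [AddCommMonoid S] [PartialOrder S] (a : S) : Prop :=
  ∀ a' : S, WayBelow a' a → ∃ k : ℕ, (k + 1) • a' ≤ k • a

/-! ### The index set of paths -/

namespace IQ

instance : DenselyOrdered IQ := inferInstanceAs (DenselyOrdered (Set.Ioo (0 : ℚ) 1))

instance : NoMaxOrder IQ := inferInstanceAs (NoMaxOrder (Set.Ioo (0 : ℚ) 1))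

instance : NoMinOrder IQ := inferInstanceAs (NoMinOrder (Set.Ioo (0 : ℚ) 1))

instance : Nonempty IQ := ⟨⟨1 / 2, by norm_num, by norm_num⟩⟩

/-- The point at proportion `t` of the interval from `a` to `b`. -/
def segment {a b : IQ} (h : a < b) (t : IQ) : IQ :=
  ⟨a.1 + t.1 * (b.1 - a.1), by
    have h' : 0 < b.1 - a.1 := sub_pos.2 h
    have h1 := mul_pos t.2.1 h'
    have h2 := mul_lt_of_lt_one_left h' t.2.2
    exact ⟨by linarith [a.2.1], by linarith [b.2.2]⟩⟩

theorem left_lt_segment {a b : IQ} (h : a < b) (t : IQ) : a < segment h t := by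
  have h1 := mul_pos t.2.1 (sub_pos.2 (show a.1 < b.1 from h))
  show a.1 < a.1 + t.1 * (b.1 - a.1)
  linarith

theorem segment_lt_right {a b : IQ} (h : a < b) (t : IQ) : segment h t < b := by
  have h1 := mul_lt_of_lt_one_left (sub_pos.2 (show a.1 < b.1 from h)) t.2.2
  show a.1 + t.1 * (b.1 - a.1) < b.1
  linarith

theorem segment_strictMono {a b : IQ} (h : a < b) : StrictMono (segment h) := by
  intro s t hst
  have h1 := mul_lt_mul_of_pos_right (show s.1 < t.1 from hst)
    (sub_pos.2 (show a.1 < b.1 from h))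
  show a.1 + s.1 * (b.1 - a.1) < a.1 + t.1 * (b.1 - a.1)
  linarith

/-- The scaling map `t ↦ c * t` on `ℚ ∩ (0,1)`. -/
def scale (c t : IQ) : IQ :=
  ⟨c.1 * t.1, mul_pos c.2.1 t.2.1, mul_lt_one_of_nonneg_of_lt_one_left c.2.1.le c.2.2 t.2.2.le⟩

theorem scale_lt (c t : IQ) : scale c t < c := mul_lt_of_lt_one_right c.2.1 t.2.2

theorem scale_strictMono (c : IQ) : StrictMono (scale c) :=
  fun s t h => mul_lt_mul_of_pos_left (show s.1 < t.1 from h) c.2.1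

theorem exists_scale_eq {c l : IQ} (h : l < c) : ∃ t, scale c t = l :=
  ⟨⟨l.1 / c.1, div_pos l.2.1 c.2.1, (div_lt_one c.2.1).2 h⟩,
    Subtype.ext (mul_div_cancel₀ _ c.2.1.ne')⟩

theorem exists_strictMono_cofinal :
    ∃ k : ℕ → IQ, StrictMono k ∧ ∀ l : IQ, ∃ n, l < k n := by
  have hpos : ∀ n : ℕ, (0 : ℚ) < (n : ℚ) + 1 := fun n => by positivity
  refine ⟨fun n => ⟨1 - 1 / ((n + 1 : ℕ) + 1 : ℚ), ?_, ?_⟩, ?_, ?_⟩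
  · have : 1 / (((n + 1 : ℕ) : ℚ) + 1) < 1 := by
      rw [div_lt_one (hpos _)]; push_cast; linarith [hpos n]
    linarith
  · have := one_div_pos.2 (hpos (n + 1))
    linarith
  · refine strictMono_nat_of_lt_succ fun n => ?_
    exact sub_lt_sub_left (one_div_lt_one_div_of_lt (hpos _) (by push_cast; linarith)) 1
  · intro l
    obtain ⟨n, hn⟩ := exists_nat_one_div_lt (sub_pos.2 l.2.2)
    refine ⟨n, ?_⟩
    have h1 : 1 / (((n + 1 : ℕ) : ℚ) + 1) < 1 / ((n : ℚ) + 1) :=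
      one_div_lt_one_div_of_lt (hpos _) (by push_cast; linarith)
    show l.1 < 1 - 1 / (((n + 1 : ℕ) : ℚ) + 1)
    linarith

theorem exists_orderIso_sigmaLex : Nonempty (IQ ≃o (Σₗ _ : ℕ, IQ)) := by
  have : Countable (Σₗ _ : ℕ, IQ) := inferInstanceAs (Countable (Σ _ : ℕ, IQ))
  have : Nonempty (Σₗ _ : ℕ, IQ) := inferInstanceAs (Nonempty (Σ _ : ℕ, IQ))
  exact Order.iso_of_countable_dense _ _

end IQ

/-! ### Suprema and way-below in the bivariant Cu-semigroup -/

section Bivariant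

variable {S T P : Type*} [AddCommMonoid S] [PartialOrder S] [AddCommMonoid T] [PartialOrder T]
  [AddCommMonoid P] [PartialOrder P]

/-- The path `q` is a supremum of the paths `p n`, in the strong sense that every entry of `q`
is already dominated by an entry of some `p n`. -/
def IsPathSup (p : ℕ → CuPath S T) (q : CuPath S T) : Prop :=
  (∀ n, PathLE (p n) q) ∧ ∀ l, ∃ n m, Prec (q.f l) ((p n).f m)

theorem PathLE.exists_prec_bound [CuSemigroup S] {p : ℕ → CuPath S T} {q : CuPath S T} {N : ℕ}
    (h : ∀ i ≤ N, PathLE (p i) q) (l : IQ) : ∃ m, ∀ i ≤ N, Prec ((p i).f l) (q.f m) := by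
  induction N with
  | zero =>
    obtain ⟨m, hm⟩ := h 0 le_rfl l
    exact ⟨m, fun i hi => by rwa [Nat.le_zero.1 hi]⟩
  | succ N ih =>
    obtain ⟨m, hm⟩ := ih fun i hi => h i (hi.trans N.le_succ)
    obtain ⟨m', hm'⟩ := h (N + 1) le_rfl l
    obtain ⟨r, hr, hr'⟩ := IQ.exists_gt₂ m m'
    refine ⟨r, fun i hi => ?_⟩
    rcases Nat.le_succ_iff.1 hi with hi | rfl
    · exact (hm i hi).trans (q.prec _ _ hr)
    · exact hm'.trans (q.prec _ _ hr')

theorem pathLE_of_le {p : ℕ → CuPath S T} [CuSemigroup S] (hp : ∀ n, PathLE (p n) (p (n + 1)))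
    {i j : ℕ} (h : i ≤ j) : PathLE (p i) (p j) := by
  induction j, h using Nat.le_induction with
  | base => exact PathLE.refl _
  | succ j _ ih => exact ih.trans (hp j)

/-- The concatenation of segments of paths `p n` between `a n` and `b n`. -/
theorem exists_concat [CuSemigroup S] (p : ℕ → CuPath S T) (a b : ℕ → IQ)
    (hab : ∀ n, a n < b n) (hp : ∀ n, Prec ((p n).f (b n)) ((p (n + 1)).f (a (n + 1)))) :
    ∃ q : CuPath S T, (∀ l, ∃ n, Prec (q.f l) ((p n).f (b n))) ∧
      ∀ n, ∃ l, Prec ((p n).f (a n)) (q.f l) := by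
  obtain ⟨e⟩ := IQ.exists_orderIso_sigmaLex
  have hlt : ∀ i j, i < j → Prec ((p i).f (b i)) ((p j).f (a j)) := by
    intro i j hij
    induction j, hij using Nat.le_induction with
    | base => exact hp i
    | succ j _ ih => exact (ih.trans ((p j).prec _ _ (hab j))).trans (hp j)
  refine ⟨⟨fun l => (p (e l).1).f (IQ.segment (hab (e l).1) (e l).2), ?_⟩, ?_, ?_⟩
  · intro l m hlm
    have h : e l < e m := e.strictMono hlm
    generalize e l = x at h
    generalize e m = y at h
    cases h with
    | left s t hst =>
      exact ((p _).prec _ _ (IQ.segment_lt_right _ _)).trans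
        ((hlt _ _ hst).trans ((p _).prec _ _ (IQ.left_lt_segment _ _)))
    | right s t hst => exact (p _).prec _ _ (IQ.segment_strictMono _ hst)
  · exact fun l => ⟨(e l).1, (p _).prec _ _ (IQ.segment_lt_right _ _)⟩
  · intro n
    obtain ⟨l, hl⟩ := e.surjective ⟨n, Classical.arbitrary IQ⟩
    refine ⟨l, ?_⟩
    show Prec _ ((p (e l).1).f (IQ.segment (hab (e l).1) (e l).2))
    rw [hl]
    exact (p n).prec _ _ (IQ.left_lt_segment _ _)

theorem exists_isPathSup [CuSemigroup S] {p : ℕ → CuPath S T}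
    (hp : ∀ n, PathLE (p n) (p (n + 1))) : ∃ q, IsPathSup p q := by
  obtain ⟨k, hk, hcof⟩ := IQ.exists_strictMono_cofinal
  have hstep : ∀ n l, ∃ m l' : IQ, l < m ∧ k n < m ∧
      ∀ i ≤ n, Prec ((p i).f m) ((p (n + 1)).f l') := by
    intro n l
    obtain ⟨m, hlm, hkm⟩ := IQ.exists_gt₂ l (k n)
    obtain ⟨l', hl'⟩ := PathLE.exists_prec_bound (p := p) (N := n) (q := p (n + 1))
      (fun i hi => pathLE_of_le hp (hi.trans n.le_succ)) m
    exact ⟨m, l', hlm, hkm, hl'⟩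
  choose m l' hlm hkm hprec using hstep
  let a : ℕ → IQ := fun n => Nat.rec (Classical.arbitrary IQ) (fun n l => l' n l) n
  obtain ⟨q, hq, hq'⟩ := exists_concat p a (fun n => m n (a n)) (fun n => hlm n _)
    (fun n => hprec n _ n le_rfl)
  refine ⟨q, fun i l => ?_, fun l => (hq l).imp fun n hn => ⟨_, hn⟩⟩
  obtain ⟨n, hn⟩ := hcof l
  have h : l < m (max i n) (a (max i n)) :=
    (hn.trans_le (hk.monotone (le_max_right i n))).trans (hkm _ _)
  obtain ⟨r, hr⟩ := hq' (max i n + 1)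
  exact ⟨r, ((p i).prec _ _ h).trans ((hprec _ _ i (le_max_left i n)).trans hr)⟩

theorem IsPathSup.isLUB [CuSemigroup S] {p : ℕ → CuPath S T} {q : CuPath S T}
    (h : IsPathSup p q) : IsLUB (Set.range fun n => BivCu.mk (p n)) (BivCu.mk q) := by
  refine ⟨?_, ?_⟩
  · rintro _ ⟨n, rfl⟩
    exact h.1 n
  · rintro ⟨r⟩ hr l
    obtain ⟨n, m, hnm⟩ := h.2 l
    obtain ⟨m', hm'⟩ := (show PathLE (p n) r from hr ⟨n, rfl⟩) m
    exact ⟨m', hnm.trans hm'⟩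

theorem isLUB_mk_iff [CuSemigroup S] {p : ℕ → CuPath S T} {q : CuPath S T}
    (hp : Monotone fun n => BivCu.mk (p n)) :
    IsLUB (Set.range fun n => BivCu.mk (p n)) (BivCu.mk q) ↔ IsPathSup p q := by
  refine ⟨fun h => ⟨fun n => h.1 ⟨n, rfl⟩, fun l => ?_⟩, IsPathSup.isLUB⟩
  obtain ⟨r, hr⟩ := exists_isPathSup (p := p) fun n => hp n.le_succ
  obtain ⟨m, hm⟩ := (show PathLE q r from h.2 hr.isLUB.1) l
  obtain ⟨n, t, hnt⟩ := hr.2 m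
  exact ⟨n, t, hm.trans hnt⟩

/-- The initial part of a path below the index `c`. -/
def CuPath.cut (p : CuPath S T) (c : IQ) : CuPath S T where
  f l := p.f (IQ.scale c l)
  prec _ _ h := p.prec _ _ (IQ.scale_strictMono c h)

theorem isPathSup_cut (p : CuPath S T) {k : ℕ → IQ} (hcof : ∀ l, ∃ n, l < k n) :
    IsPathSup (fun n => p.cut (k n)) p := by
  refine ⟨fun n l => ⟨k n, p.prec _ _ (IQ.scale_lt _ _)⟩, fun l => ?_⟩
  obtain ⟨l', hl'⟩ := IQ.exists_gt l
  obtain ⟨n, hn⟩ := hcof l'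
  obtain ⟨t, rfl⟩ := IQ.exists_scale_eq hn
  exact ⟨n, t, p.prec _ _ hl'⟩

theorem pathLE_cut_cut (p : CuPath S T) {c d : IQ} (h : c < d) :
    PathLE (p.cut c) (p.cut d) := by
  obtain ⟨t, rfl⟩ := IQ.exists_scale_eq h
  exact fun l => ⟨t, p.prec _ _ (IQ.scale_lt _ _)⟩

theorem wayBelow_mk_iff [CuSemigroup S] {p q : CuPath S T} :
    WayBelow (BivCu.mk p) (BivCu.mk q) ↔ ∃ m, ∀ l, Prec (p.f l) (q.f m) := by
  constructor
  · intro h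
    obtain ⟨k, hk, hcof⟩ := IQ.exists_strictMono_cofinal
    obtain ⟨n, hn⟩ := h (fun n => BivCu.mk (q.cut (k n)))
      (monotone_nat_of_le_succ fun n => pathLE_cut_cut q (hk n.lt_succ_self)) _
      (isPathSup_cut q hcof).isLUB le_rfl
    refine ⟨k n, fun l => ?_⟩
    obtain ⟨m, hm⟩ := (show PathLE p (q.cut (k n)) from hn) l
    exact hm.trans (q.prec _ _ (IQ.scale_lt _ _))
  · rintro ⟨m, hm⟩ c hc s hs hqs
    obtain ⟨r, rfl⟩ : ∃ r : ℕ → CuPath S T, c = fun n => BivCu.mk (r n) :=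
      ⟨fun n => (c n).out, funext fun n => (Quotient.out_eq (c n)).symm⟩
    obtain ⟨s, rfl⟩ : ∃ s' : CuPath S T, s = BivCu.mk s' :=
      ⟨s.out, (Quotient.out_eq s).symm⟩
    obtain ⟨m', hm'⟩ := (show PathLE q s from hqs) m
    obtain ⟨n, t, ht⟩ := ((isLUB_mk_iff hc).1 hs).2 m'
    exact ⟨n, fun l => ⟨t, (hm l).trans (hm'.trans ht)⟩⟩

theorem BivCu.exists_mk_eq [CuSemigroup S] (x : BivCu S T) : ∃ p, BivCu.mk p = x :=
  Quotient.exists_rep x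

theorem BivCu.exists_mk_seq_eq [CuSemigroup S] (c : ℕ → BivCu S T) :
    ∃ p : ℕ → CuPath S T, (fun n => BivCu.mk (p n)) = c :=
  ⟨fun n => (c n).out, funext fun n => Quotient.out_eq (c n)⟩

instance BivCu.instCuSemigroup [CuSemigroup S] [CuSemigroup T] : CuSemigroup (BivCu S T) where
  add_le_add' := by
    rintro ⟨a⟩ ⟨b⟩ ⟨c⟩ ⟨d⟩ hab hcd
    exact PathLE.add (show PathLE a b from hab) hcd
  zero_le' := by
    rintro ⟨p⟩ l
    exact ⟨l, fun _ _ _ => wayBelow_zero⟩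
  O1 c hc := by
    obtain ⟨p, rfl⟩ := BivCu.exists_mk_seq_eq c
    obtain ⟨q, hq⟩ := exists_isPathSup (p := p) fun n => hc n.le_succ
    exact ⟨_, hq.isLUB⟩
  O2 := by
    rintro ⟨p⟩
    obtain ⟨k, hk, hcof⟩ := IQ.exists_strictMono_cofinal
    refine ⟨fun n => BivCu.mk (p.cut (k n)), fun n => wayBelow_mk_iff.2 ?_,
      (isPathSup_cut p hcof).isLUB⟩
    obtain ⟨t, ht⟩ := IQ.exists_scale_eq (hk n.lt_succ_self)
    refine ⟨t, fun l => ?_⟩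
    show Prec (p.f (IQ.scale (k n) l)) (p.f (IQ.scale (k (n + 1)) t))
    rw [ht]
    exact p.prec _ _ (IQ.scale_lt _ _)
  O3 := by
    rintro ⟨a'⟩ ⟨a⟩ ⟨b'⟩ ⟨b⟩ ha hb
    obtain ⟨m, hm⟩ := wayBelow_mk_iff.1 ha
    obtain ⟨n, hn⟩ := wayBelow_mk_iff.1 hb
    obtain ⟨r, hmr, hnr⟩ := IQ.exists_gt₂ m n
    exact wayBelow_mk_iff.2 ⟨r, fun l =>
      ((hm l).trans (a.prec _ _ hmr)).add ((hn l).trans (b.prec _ _ hnr))⟩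
  O4 c d s t hc hd hs ht := by
    obtain ⟨p, rfl⟩ := BivCu.exists_mk_seq_eq c
    obtain ⟨q, rfl⟩ := BivCu.exists_mk_seq_eq d
    obtain ⟨s, rfl⟩ := BivCu.exists_mk_eq s
    obtain ⟨t, rfl⟩ := BivCu.exists_mk_eq t
    have hs := (isLUB_mk_iff hc).1 hs
    have ht := (isLUB_mk_iff hd).1 ht
    refine IsPathSup.isLUB (p := fun n => (p n).add (q n)) (q := s.add t)
      ⟨fun n => (hs.1 n).add (ht.1 n), fun l => ?_⟩
    obtain ⟨i, m, hi⟩ := hs.2 l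
    obtain ⟨j, m', hj⟩ := ht.2 l
    obtain ⟨n, hn⟩ := (show PathLE (p i) (p (max i j)) from hc (le_max_left i j)) m
    obtain ⟨n', hn'⟩ := (show PathLE (q j) (q (max i j)) from hd (le_max_right i j)) m'
    obtain ⟨r, hr, hr'⟩ := IQ.exists_gt₂ n n'
    exact ⟨max i j, r, (hi.trans (hn.trans ((p _).prec _ _ hr))).add
      (hj.trans (hn'.trans ((q _).prec _ _ hr')))⟩

theorem BivCu.isLUB_comp [CuSemigroup S] [CuSemigroup T] (c : ℕ → BivCu T P)
    (d : ℕ → BivCu S T) (s : BivCu T P) (t : BivCu S T) (hc : Monotone c) (hd : Monotone d)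
    (hs : IsLUB (Set.range c) s) (ht : IsLUB (Set.range d) t) :
    IsLUB (Set.range fun n => BivCu.comp (c n) (d n)) (BivCu.comp s t) := by
  obtain ⟨p, rfl⟩ := BivCu.exists_mk_seq_eq c
  obtain ⟨q, rfl⟩ := BivCu.exists_mk_seq_eq d
  obtain ⟨s, rfl⟩ := BivCu.exists_mk_eq s
  obtain ⟨t, rfl⟩ := BivCu.exists_mk_eq t
  have hs := (isLUB_mk_iff hc).1 hs
  have ht := (isLUB_mk_iff hd).1 ht
  refine IsPathSup.isLUB (p := fun n => (p n).comp (q n)) (q := s.comp t)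
    ⟨fun n => (hs.1 n).comp (ht.1 n), fun l => ?_⟩
  obtain ⟨i, m, hi⟩ := hs.2 l
  obtain ⟨j, m', hj⟩ := ht.2 l
  obtain ⟨n, hn⟩ := (show PathLE (p i) (p (max i j)) from hc (le_max_left i j)) m
  obtain ⟨n', hn'⟩ := (show PathLE (q j) (q (max i j)) from hd (le_max_right i j)) m'
  obtain ⟨r, hr, hr'⟩ := IQ.exists_gt₂ n n'
  exact ⟨max i j, r, Prec.comp (hj.trans (hn'.trans ((q _).prec _ _ hr')))
    (hi.trans (hn.trans ((p _).prec _ _ hr)))⟩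

theorem BivCu.wayBelow_comp [CuSemigroup S] [CuSemigroup T] {y' y : BivCu T P}
    {x' x : BivCu S T} (hy : WayBelow y' y) (hx : WayBelow x' x) :
    WayBelow (BivCu.comp y' x') (BivCu.comp y x) := by
  obtain ⟨p', rfl⟩ := BivCu.exists_mk_eq y'
  obtain ⟨p, rfl⟩ := BivCu.exists_mk_eq y
  obtain ⟨q', rfl⟩ := BivCu.exists_mk_eq x'
  obtain ⟨q, rfl⟩ := BivCu.exists_mk_eq x
  obtain ⟨m, hm⟩ := wayBelow_mk_iff.1 hy
  obtain ⟨n, hn⟩ := wayBelow_mk_iff.1 hx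
  obtain ⟨r, hmr, hnr⟩ := IQ.exists_gt₂ m n
  exact wayBelow_mk_iff.2 ⟨r, fun l =>
    Prec.comp ((hn l).trans (q.prec _ _ hnr)) ((hm l).trans (p.prec _ _ hmr))⟩

theorem BivCu.isCuBimor_comp [CuSemigroup S] [CuSemigroup T] [CuSemigroup P] :
    IsCuBimor (fun (y : BivCu T P) (x : BivCu S T) => BivCu.comp y x) := by
  refine ⟨?_, ?_, ?_, ?_, ?_, ?_, BivCu.isLUB_comp, fun _ _ _ _ => BivCu.wayBelow_comp⟩
  · rintro ⟨p⟩
    rfl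
  · rintro ⟨p⟩
    exact congrArg BivCu.mk (CuPath.ext' (funext fun l =>
      GenCuMor.ext' (funext fun _ => (p.f l).map_zero')))
  · rintro ⟨p⟩ ⟨q⟩ ⟨r⟩
    rfl
  · rintro ⟨p⟩ ⟨q⟩ ⟨r⟩
    exact congrArg BivCu.mk (CuPath.ext' (funext fun l =>
      GenCuMor.ext' (funext fun _ => (p.f l).map_add' _ _)))
  · rintro ⟨p⟩ ⟨q⟩ ⟨r⟩ h
    exact PathLE.comp (show PathLE p q from h) (PathLE.refl r)
  · rintro ⟨p⟩ ⟨q⟩ ⟨r⟩ h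
    exact PathLE.comp (PathLE.refl p) (show PathLE q r from h)

end Bivariant

/-- For a Cu-semigroup `S`, the bivariant Cu-semigroup `⟦S,S⟧`, with the
composition product as multiplication and the class of the constant path at the identity
as unit, is a (not necessarily commutative) Cu-semiring whose unit is a compact element. -/
theorem bivariant_endomorphism_CuSemiring
    (S : Type*) [AddCommMonoid S] [PartialOrder S] [CuSemigroup S] :
    CuSemigroup (BivCu S S) ∧
    IsCuBimor (fun y x : BivCu S S => BivCu.comp y x) ∧
    (∀ x y z : BivCu S S, BivCu.comp (BivCu.comp x y) z = BivCu.comp x (BivCu.comp y z)) ∧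
    (∀ x : BivCu S S, BivCu.comp (BivCu.id S) x = x) ∧
    (∀ x : BivCu S S, BivCu.comp x (BivCu.id S) = x) ∧
    WayBelow (BivCu.id S) (BivCu.id S) := by
  refine ⟨BivCu.instCuSemigroup, BivCu.isCuBimor_comp, ?_, ?_, ?_, ?_⟩
  · rintro ⟨p⟩ ⟨q⟩ ⟨r⟩
    rfl
  · rintro ⟨p⟩
    rfl
  · rintro ⟨p⟩
    rfl
  · exact wayBelow_mk_iff.2 ⟨Classical.arbitrary IQ, fun _ _ _ h => h⟩
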